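/- Let $v_1,v_2,v_3$ be strictly positive measurable functions on $\mathbb{R}^d$ with $v_1^{1/3}v_2^{1/3}v_3^{1/3}=1$. Let $0<\epsilon$ be small, $\vec p=(1+\epsilon,1+\epsilon,1+\epsilon)$, and $1+t=\frac{2(1+\epsilon)}{2-\epsilon}$. Then $$[\vec v]_{A_{\vec 3}^{\vec p}} \le [v_1^{1+t}]_{A_3}^{\frac{1}{3(1+t)}}\cdot[v_2^{1+t}]_{A_3}^{\frac{1}{3(1+t)}},$$ whenever $v_1^{1+t},v_2^{1+t}\in A_3$, where $\vec 3=(3,3,3)$. -/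

import Mathlib

open MeasureTheory ENNReal NNReal Set Filter Function Topology

noncomputable section

abbrev Rd (d : ℕ) := EuclideanSpace ℝ (Fin d)
abbrev R2d (d : ℕ) := EuclideanSpace ℝ (Fin d ⊕ Fin d)

/-- Axis-parallel closed cube with corner `c` and side length `r`. -/
def Cube {d : ℕ} (c : Rd d) (r : ℝ) : Set (Rd d) :=
  {x | ∀ i, c i ≤ x i ∧ x i ≤ c i + r}

def IsCube {d : ℕ} (Q : Set (Rd d)) : Prop := ∃ c r, 0 < r ∧ Q = Cube c r

/-- `L^p` average `(f)_{p,Q} = (|Q|⁻¹ ∫_Q |f|^p)^{1/p}`. -/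
def lavg {d : ℕ} (p : ℝ) (Q : Set (Rd d)) (f : Rd d → ℝ) : ℝ≥0∞ :=
  ((volume Q)⁻¹ * ∫⁻ x in Q, ENNReal.ofReal |f x| ^ p) ^ (1 / p)

def lavgE {d : ℕ} (p : ℝ≥0∞) (Q : Set (Rd d)) (f : Rd d → ℝ) : ℝ≥0∞ :=
  if p = ⊤ then eLpNorm (Q.indicator f) ⊤ volume else lavg p.toReal Q f

/-- η-sparse collection of cubes. -/
def IsSparse {d : ℕ} (η : ℝ≥0∞) (S : Set (Set (Rd d))) : Prop :=
  (∀ Q ∈ S, IsCube Q) ∧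
  ∃ E : Set (Rd d) → Set (Rd d),
    (∀ Q ∈ S, E Q ⊆ Q ∧ η * volume Q ≤ volume (E Q)) ∧ S.PairwiseDisjoint E

/-- Positive sparse form. -/
def PSF {d n : ℕ} (S : Set (Set (Rd d))) (p : Fin n → ℝ≥0∞)
    (f : Fin n → Rd d → ℝ) : ℝ≥0∞ :=
  ∑' Q : S, volume (Q : Set (Rd d)) * ∏ i, lavgE (p i) (Q : Set (Rd d)) (f i)

def sparseSup {d n : ℕ} (η : ℝ≥0∞) (p : Fin n → ℝ≥0∞) (f : Fin n → Rd d → ℝ) : ℝ≥0∞ :=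
  ⨆ (S : Set (Set (Rd d))) (_ : IsSparse η S), PSF S p f

/-- The `p`-th Hardy–Littlewood maximal function (over cubes). -/
def maxFn {d : ℕ} (p : ℝ) (h : Rd d → ℝ) (x : Rd d) : ℝ≥0∞ :=
  ⨆ (c : Rd d) (r : ℝ) (_ : 0 < r) (_ : x ∈ Cube c r), lavg p (Cube c r) h

/-- A (shifted) dyadic cube datum: scale and position. -/
abbrev DC (d : ℕ) := ℤ × (Fin d → ℤ)

def dside {d : ℕ} (L : DC d) : ℝ := 2 ^ L.1
def dcorner {d : ℕ} (τ : Rd d) (L : DC d) (i : Fin d) : ℝ := τ i + (L.2 i : ℝ) * dside L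
def dcenter {d : ℕ} (τ : Rd d) (L : DC d) (i : Fin d) : ℝ := dcorner τ L i + dside L / 2
def dSet {d : ℕ} (τ : Rd d) (L : DC d) : Set (Rd d) :=
  {x | ∀ i, dcorner τ L i ≤ x i ∧ x i < dcorner τ L i + dside L}

/-- The `lam`-fold (closed) dilate of a dyadic cube. -/
def dilate {d : ℕ} (τ : Rd d) (L : DC d) (lam : ℝ) : Set (Rd d) :=
  {x | ∀ i, |x i - dcenter τ L i| ≤ lam * dside L / 2}

/-- A stopping collection with top `top`, inside the dyadic lattice shifted by `shift`. -/
structure Stopping (d : ℕ) where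
  shift : Rd d
  top : DC d
  mem : Set (DC d)
  disj : mem.PairwiseDisjoint (dSet shift)
  sub3Q : ∀ L ∈ mem, dSet shift L ⊆ dilate shift top 3
  sep : ∀ L ∈ mem, ∀ R ∈ mem, 8 ≤ |L.1 - R.1| → dilate shift L 7 ∩ dilate shift R 7 = ∅
  cover : (⋃ L ∈ {L ∈ mem | (dilate shift L 3 ∩ dilate shift top 2).Nonempty}, dilate shift L 9)
      ⊆ ⋃ L ∈ mem, dSet shift L

/-- The `𝒴_p` norm associated to a stopping collection. -/
def Ynorm {d : ℕ} (P : Stopping d) (p : ℝ≥0∞) (h : Rd d → ℝ) : ℝ≥0∞ :=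
  if p = ⊤ then eLpNorm h ⊤ volume else
  max (eLpNorm (((⋃ L ∈ P.mem, dSet P.shift L)ᶜ).indicator h) ⊤ volume)
      (⨆ L ∈ P.mem, ⨅ x ∈ dilate P.shift L 32, maxFn p.toReal h x)

/-- `b = ∑_{L ∈ 𝒫} b_L`. -/
def bSum {d : ℕ} (P : Stopping d) (bL : DC d → Rd d → ℝ) : Rd d → ℝ :=
  fun x => ∑ᶠ L ∈ P.mem, bL L x

def IsXfam {d : ℕ} (P : Stopping d) (bL : DC d → Rd d → ℝ) : Prop :=
  ∀ L ∈ P.mem, Function.support (bL L) ⊆ dSet P.shift L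

def IsXdotFam {d : ℕ} (P : Stopping d) (bL : DC d → Rd d → ℝ) : Prop :=
  IsXfam P bL ∧ ∀ L ∈ P.mem, (∫ x, bL L x) = 0

/-- Single-scale kernel support condition: on the support of `K_s`, `|x_k - x_l| ≤ 2^s`. -/
def KernSupp (d m : ℕ) (Ks : ℤ → (Fin (m+1) → Rd d) → ℝ) : Prop :=
  ∀ s x, Ks s x ≠ 0 → ∀ k l, dist (x k) (x l) ≤ 2 ^ s

/-- The single-scale quantity `[K]_p`. -/
def kernNorm (d m : ℕ) (Ks : ℤ → (Fin (m+1) → Rd d) → ℝ) (p : ℝ) : ℝ≥0∞ :=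
  ⨆ (s : ℤ) (y : Rd d), ∑ j : Fin (m+1),
    ENNReal.ofReal ((2:ℝ) ^ (((m * d : ℕ) : ℝ) * (s:ℝ) * (1 - 1/p))) *
      (∫⁻ z : Fin m → Rd d,
        ENNReal.ofReal |Ks s (j.insertNth y (fun i => z i + y))| ^ p) ^ (1/p)

/-- Truncated `(m+1)`-linear form `Λ_μ^ν`. -/
def form {d m : ℕ} (Ks : ℤ → (Fin (m+1) → Rd d) → ℝ) (μ ν : ℤ)
    (f : Fin (m+1) → Rd d → ℝ) : ℝ :=
  ∫ x : Fin (m+1) → Rd d, (∑ s ∈ Finset.Ioo μ ν, Ks s x) * ∏ i, f i (x i)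

/-- Truncated form with all scales at or below `t`. -/
def formAt {d m : ℕ} (Ks : ℤ → (Fin (m+1) → Rd d) → ℝ) (μ ν t : ℤ)
    (f : Fin (m+1) → Rd d → ℝ) : ℝ :=
  form Ks μ (min ν (t+1)) f

/-- The localized form `Λ_𝒫`. -/
def formP {d m : ℕ} (Ks : ℤ → (Fin (m+1) → Rd d) → ℝ) (μ ν : ℤ) (P : Stopping d)
    (f : Fin (m+1) → Rd d → ℝ) : ℝ :=
  formAt Ks μ ν P.top.1 (Function.update f 0 ((dSet P.shift P.top).indicator (f 0)))
  - ∑ᶠ L ∈ {L ∈ P.mem | dSet P.shift L ⊆ dSet P.shift P.top},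
      formAt Ks μ ν L.1 (Function.update f 0 ((dSet P.shift L).indicator (f 0)))

/-- Dual exponent. -/
def dualE (p : ℝ≥0∞) : ℝ≥0∞ := (1 - p⁻¹)⁻¹

def pairFn {d : ℕ} (a b : Rd d) : R2d d :=
  (EuclideanSpace.equiv (Fin d ⊕ Fin d) ℝ).symm (fun i => Sum.elim (fun j => a j) (fun j => b j) i)

def yfst {d : ℕ} (y : R2d d) : Rd d :=
  (EuclideanSpace.equiv (Fin d) ℝ).symm (fun i => y (Sum.inl i))

def ysnd {d : ℕ} (y : R2d d) : Rd d :=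
  (EuclideanSpace.equiv (Fin d) ℝ).symm (fun i => y (Sum.inr i))

/-- `Ω` is homogeneous of degree `0`. -/
def Homog0 {d : ℕ} (Ω : R2d d → ℝ) : Prop := ∀ c : ℝ, 0 < c → ∀ y, Ω (c • y) = Ω y

/-- Mean zero over the unit sphere `S^{2d-1}`. -/
def MeanZero {d : ℕ} (Ω : R2d d → ℝ) : Prop :=
  (∫ θ : Metric.sphere (0 : R2d d) 1, Ω θ ∂((volume : Measure (R2d d)).toSphere)) = 0

/-- The rough bilinear singular integral, defined as a principal value. -/
def TOmega (d : ℕ) (Ω : R2d d → ℝ) (f₁ f₂ : Rd d → ℝ) (x : Rd d) : ℝ :=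
  limUnder (𝓝[>] (0:ℝ)) fun ε =>
    ∫ y in {y : R2d d | ε < ‖y‖}, f₁ (x - yfst y) * f₂ (x - ysnd y) * Ω y / ‖y‖ ^ (2*d)

/-- The measure `w(x) dx`. -/
def wMeasure {d : ℕ} (w : Rd d → ℝ) : Measure (Rd d) :=
  volume.withDensity fun x => ENNReal.ofReal (w x)

/-- The Muckenhoupt `A_p` characteristic. -/
def ApConst (d : ℕ) (p : ℝ) (w : Rd d → ℝ) : ℝ≥0∞ :=
  ⨆ (c : Rd d) (r : ℝ) (_ : 0 < r),
    ((volume (Cube c r))⁻¹ * ∫⁻ x in Cube c r, ENNReal.ofReal (w x)) *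
      ((volume (Cube c r))⁻¹ * ∫⁻ x in Cube c r, ENNReal.ofReal (w x ^ (-(1/(p-1))))) ^ (p-1)

def MemAp (d : ℕ) (p : ℝ) (w : Rd d → ℝ) : Prop :=
  (∀ x, 0 < w x) ∧ LocallyIntegrable w volume ∧ ApConst d p w ≠ ⊤

/-- The multilinear Muckenhoupt characteristic `[v]_{A_q^p}` (trilinear case). -/
def MultiAp (d : ℕ) (pv qv : Fin 3 → ℝ) (v : Fin 3 → Rd d → ℝ) : ℝ≥0∞ :=
  ⨆ (c : Rd d) (r : ℝ) (_ : 0 < r),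
    ∏ i, ((volume (Cube c r))⁻¹ *
      ∫⁻ x in Cube c r, ENNReal.ofReal (v i x ^ (pv i / (pv i - qv i)))) ^ (1 / pv i - 1 / qv i)

/-- Largest pairwise distance among the coordinates. -/
def maxDist {d m : ℕ} (x : Fin (m+1) → Rd d) : ℝ := ⨆ i, ⨆ j, dist (x i) (x j)

/-- The basic size estimate of an `m`-linear Calderón–Zygmund kernel. -/
def CZsize (d m : ℕ) (K : (Fin (m+1) → Rd d) → ℝ) (CK : ℝ) : Prop :=
  ∀ x, maxDist x ≠ 0 → |K x| ≤ CK * maxDist x ^ (-((m * d : ℕ) : ℝ))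

/-- The `ε`-smoothness condition with constant `A` (in each variable). -/
def CZsmooth (d m : ℕ) (K : (Fin (m+1) → Rd d) → ℝ) (ε A : ℝ) : Prop :=
  ∀ (k : Fin (m+1)) (x : Fin (m+1) → Rd d) (x' : Rd d),
    maxDist x ≠ 0 → maxDist (Function.update x k x') ≠ 0 →
    dist (x k) x' ≤ (1/(m+1 : ℝ)) * ∑ i, dist (x i) (x k) →
    |K x - K (Function.update x k x')| ≤
      A * dist (x k) x' ^ ε * maxDist x ^ (-((m * d : ℕ) : ℝ) - ε)

def Mstar {d m : ℕ} (i j : Fin (m+1)) : Set (Fin (m+1) → Rd d) :=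
  {x | ∀ k l, dist (x k) (x l) < 2 * dist (x i) (x j)}

def Mset {d m : ℕ} (i j : Fin (m+1)) : Set (Fin (m+1) → Rd d) :=
  {x | ∀ k l, dist (x k) (x l) ≤ dist (x i) (x j)}

/-- A smooth partition of unity subordinated to the cover `{M_{ij}^*}`. -/
def IsCZPartition (d m : ℕ) (ψ : Fin (m+1) → Fin (m+1) → (Fin (m+1) → Rd d) → ℝ) : Prop :=
  (∀ i j, ContDiffOn ℝ (⊤ : ℕ∞) (ψ i j) {0}ᶜ) ∧
  (∀ i j, Function.support (ψ i j) ⊆ Mstar (d := d) i j) ∧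
  (∀ i j x, 0 ≤ ψ i j x ∧ ψ i j x ≤ 1) ∧
  (∀ x : Fin (m+1) → Rd d, x ≠ 0 → (∑ i, ∑ j, if i < j then ψ i j x else 0) = 1) ∧
  (∀ i j, i < j → ∀ x ∈ Mset (d := d) i j, ψ i j x = 1)

/-- Sum of pairwise distances among the first `m` coordinates. -/
def pairSumm {d m : ℕ} (x : Fin (m+1) → Rd d) : ℝ :=
  ∑ i : Fin m, ∑ j : Fin m, if i < j then dist (x i.castSucc) (x j.castSucc) else 0

def Aset {d : ℕ} (m : ℕ) (l₀ s : ℤ) : Set (Fin (m+1) → Rd d) :=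
  {x | (2:ℝ) ^ (s - l₀ - 1) < pairSumm x ∧ pairSumm x ≤ (2:ℝ) ^ (s - 1)}

/-- Euclidean norm of the concatenated vector. -/
def enorm' {d m : ℕ} (x : Fin (m+1) → Rd d) : ℝ := Real.sqrt (∑ i, ‖x i‖ ^ 2)

/-- The smooth radial Littlewood–Paley function `φ` generating `φ_s = φ(2^{-s}·)`. -/
def IsLPfun (d m : ℕ) (l₀ : ℤ) (φ : (Fin (m+1) → Rd d) → ℝ) : Prop :=
  ContDiff ℝ (⊤ : ℕ∞) φ ∧ Function.support φ ⊆ Aset (d := d) m l₀ 0 ∧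
  (∀ x y, enorm' x = enorm' y → φ x = φ y) ∧
  (∀ x : Fin (m+1) → Rd d, x ≠ 0 → (∑ᶠ s : ℤ, φ ((2:ℝ) ^ (-s) • x)) = 1)

/-- `‖∇φ₀‖_∞`. -/
def gradNorm {d m : ℕ} (φ : (Fin (m+1) → Rd d) → ℝ) : ℝ≥0∞ :=
  ⨆ x, (‖fderiv ℝ φ x‖₊ : ℝ≥0∞)

/-- The hypotheses (3.1) of the abstract sparse domination theorem, with constant `CL`
and exponent tuple `p`. -/
def AssumpL {d m : ℕ} (Ks : ℤ → (Fin (m+1) → Rd d) → ℝ) (p : Fin (m+1) → ℝ≥0∞)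
    (CL : ℝ≥0∞) : Prop :=
  ∀ (P : Stopping d) (μ ν : ℤ) (k : Fin (m+1)) (bL : DC d → Rd d → ℝ),
    IsXdotFam P bL →
    ∀ g : Fin (m+1) → Rd d → ℝ,
      (∀ i, i ≠ k → Function.support (g i) ⊆ dilate P.shift P.top 3) →
      ENNReal.ofReal |formP Ks μ ν P (Function.update g k (bSum P bL))| ≤
        CL * volume (dSet P.shift P.top) *
          ((∏ i ∈ Finset.univ.filter (fun i => i < k), Ynorm P ⊤ (g i)) *
            (Ynorm P (p k) (bSum P bL) *
              ∏ i ∈ Finset.univ.filter (fun i => k < i), Ynorm P (p i) (g i)))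

/-- The factor of a cube in the `A_3` characteristic of `w = u ^ s`, written with powers of `u`,
is at most the characteristic. -/
lemma avg_mul_avg_rpow_le_ApConst_three {d : ℕ} {u : Rd d → ℝ} (hu : ∀ x, 0 < u x) (s : ℝ)
    (c : Rd d) {r : ℝ} (hr : 0 < r) :
    ((volume (Cube c r))⁻¹ * ∫⁻ x in Cube c r, ENNReal.ofReal (u x ^ s)) *
      ((volume (Cube c r))⁻¹ * ∫⁻ x in Cube c r, ENNReal.ofReal (u x ^ (-(s / 2)))) ^ (2 : ℝ) ≤
      ApConst d 3 fun x => u x ^ s := by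
  have hpow : ∀ x, u x ^ (-(s / 2)) = (u x ^ s) ^ (-(1 / ((3 : ℝ) - 1))) := fun x => by
    rw [← Real.rpow_mul (hu x).le]
    congr 1
    ring
  simp only [hpow]
  rw [show (2 : ℝ) = 3 - 1 by norm_num]
  exact le_iSup₂_of_le c r (le_iSup_of_le hr le_rfl)

/-- The Cauchy-Schwarz inequality for the averages of `(f g) ^ (s / 2)`. -/
lemma avg_mul_rpow_half_le {α : Type*} [MeasurableSpace α] (μ : Measure α) (a : ℝ≥0∞)
    {f g : α → ℝ} (hf : Measurable f) (hg : Measurable g) (hf0 : ∀ x, 0 < f x)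
    (hg0 : ∀ x, 0 < g x) (s : ℝ) :
    a * ∫⁻ x, ENNReal.ofReal ((f x * g x) ^ (s / 2)) ∂μ ≤
      (a * ∫⁻ x, ENNReal.ofReal (f x ^ s) ∂μ) ^ (1 / (2 : ℝ)) *
        (a * ∫⁻ x, ENNReal.ofReal (g x ^ s) ∂μ) ^ (1 / (2 : ℝ)) := by
  have hsq : ∀ y : ℝ, 0 < y →
      ENNReal.ofReal (y ^ s) = ENNReal.ofReal (y ^ (s / 2)) ^ (2 : ℝ) := fun y hy => by
    rw [ENNReal.ofReal_rpow_of_pos (Real.rpow_pos_of_pos hy _), ← Real.rpow_mul hy.le]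
    congr 2
    ring
  have hmul : ∀ x, ENNReal.ofReal ((f x * g x) ^ (s / 2)) =
      ENNReal.ofReal (f x ^ (s / 2)) * ENNReal.ofReal (g x ^ (s / 2)) := fun x => by
    rw [Real.mul_rpow (hf0 x).le (hg0 x).le,
      ENNReal.ofReal_mul (Real.rpow_pos_of_pos (hf0 x) _).le]
  simp only [hmul, hsq _ (hf0 _), hsq _ (hg0 _), ← smul_eq_mul (a := a), ← lintegral_smul_measure]
  exact ENNReal.lintegral_mul_le_Lp_mul_Lq (a • μ) Real.HolderConjugate.two_two
    (hf.pow_const _).ennreal_ofReal.aemeasurable (hg.pow_const _).ennreal_ofReal.aemeasurable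

/-- The multilinear characteristic with tuple `(1+ε,1+ε,1+ε)` and exponents
`(3,3,3)` is controlled by the `A_3` characteristics of `v₁^{1+t}` and `v₂^{1+t}`,
where `1+t = 2(1+ε)/(2-ε)`. -/
theorem statement14 (d : ℕ) (hd : 0 < d) (ε t : ℝ) (hε : 0 < ε) (hε1 : ε < 1)
    (ht : 1 + t = 2 * (1 + ε) / (2 - ε))
    (v : Fin 3 → Rd d → ℝ) (hmeas : ∀ i, Measurable (v i)) (hpos : ∀ i x, 0 < v i x)
    (hprod : ∀ x, (∏ i, v i x ^ ((1:ℝ)/3)) = 1)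
    (h1 : MemAp d 3 fun x => v 0 x ^ (1 + t))
    (h2 : MemAp d 3 fun x => v 1 x ^ (1 + t)) :
    MultiAp d (fun _ => 1 + ε) (fun _ => 3) v ≤
      (ApConst d 3 fun x => v 0 x ^ (1 + t)) ^ (1 / (3 * (1 + t))) *
        (ApConst d 3 fun x => v 1 x ^ (1 + t)) ^ (1 / (3 * (1 + t))) := by
  have h2ε : 0 < 2 - ε := by linarith
  have hs : 0 < 1 + t := by rw [ht]; positivity
  have hexp : (1 + ε) / (1 + ε - 3) = -((1 + t) / 2) := by
    have : 1 + ε - 3 ≠ 0 := by linarith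
    rw [ht]
    field_simp
    ring
  have hexp' : 1 / (1 + ε) - 1 / 3 = 2 * (1 / (3 * (1 + t))) := by
    rw [ht]
    field_simp
    ring
  have hq : 0 ≤ 1 / (3 * (1 + t)) := by positivity
  have hv2 : ∀ x, v 2 x ^ (-((1 + t) / 2)) = (v 0 x * v 1 x) ^ ((1 + t) / 2) := fun x => by
    have h01 : 0 < v 0 x * v 1 x := mul_pos (hpos 0 x) (hpos 1 x)
    have hcube : v 0 x * v 1 x * v 2 x = 1 := by
      have h := hprod x
      rw [Real.finsetProd_rpow _ _ fun i _ => (hpos i x).le, Fin.prod_univ_three] at h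
      exact (Real.rpow_left_inj (mul_pos h01 (hpos 2 x)).le zero_le_one
        (by norm_num : (1 : ℝ) / 3 ≠ 0)).mp (h.trans (Real.one_rpow _).symm)
    rw [Real.rpow_neg (hpos 2 x).le, ← Real.inv_rpow (hpos 2 x).le,
      eq_inv_of_mul_eq_one_left hcube]
  refine iSup₂_le fun c r => iSup_le fun hr => ?_
  simp only [hexp, hexp', Fin.prod_univ_three, hv2]
  have hA0 := avg_mul_avg_rpow_le_ApConst_three (hpos 0) (1 + t) c hr
  have hA1 := avg_mul_avg_rpow_le_ApConst_three (hpos 1) (1 + t) c hr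
  have hCS := avg_mul_rpow_half_le (volume.restrict (Cube c r)) (volume (Cube c r))⁻¹
    (hmeas 0) (hmeas 1) (hpos 0) (hpos 1) (1 + t)
  refine le_trans ?_ (mul_le_mul' (ENNReal.rpow_le_rpow hA0 hq) (ENNReal.rpow_le_rpow hA1 hq))
  have hCS2 := ENNReal.rpow_le_rpow hCS (zero_le_two (α := ℝ))
  nth_rw 2 [ENNReal.mul_rpow_of_nonneg _ _ zero_le_two] at hCS2
  rw [← ENNReal.rpow_mul, ← ENNReal.rpow_mul,
    one_div_mul_cancel two_ne_zero, ENNReal.rpow_one, ENNReal.rpow_one] at hCS2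
  simp only [ENNReal.rpow_mul, ← ENNReal.mul_rpow_of_nonneg _ _ hq]
  refine ENNReal.rpow_le_rpow ((mul_le_mul_right hCS2 _).trans_eq ?_) hq
  ring

end
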